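/- arXiv:1310.8516 — 2 statements merged into one kernel-verified Lean document; each statement's English description precedes it below -/
import Mathlib

section
/- Let k be a positive integer and let q be an integer coprime to 2k. Then for every integer i, g(2k, −q, i) = g(2k, q, i + q + k). -/
/-- `g (2k, q, i) = (2k-1)/2 - (1/k) * ∑_{j=0}^{k-1} [i + q j]`, where `[m]` is the
least nonnegative residue of `m` modulo `2k`. -/
def g (k q i : ℤ) : ℚ :=
  (2 * (k : ℚ) - 1) / 2 -
    1 / (k : ℚ) * ∑ j ∈ Finset.range k.toNat, (((i + q * (j : ℤ)) % (2 * k) : ℤ) : ℚ)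

theorem g_neg (k q : ℤ) (hk : 0 < k) (hcop : IsCoprime q (2 * k)) :
    ∀ i : ℤ, g k (-q) i = g k q (i + q + k) := by
  intro i
  have hodd : Odd q := by
    obtain ⟨a, b, h⟩ := hcop
    rcases Int.even_or_odd q with ⟨c, hc⟩ | h'
    · exfalso
      subst hc
      have h2 : 2 * (a * c + b * k) = 1 := by linarith
      omega
    · exact h'
  obtain ⟨c, hc⟩ := hodd
  unfold g
  congr 2
  rw [← Finset.sum_range_reflect]
  refine Finset.sum_congr rfl fun j hj => ?_
  have hj' := Finset.mem_range.1 hj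
  have e : ((k.toNat - 1 - j : ℕ) : ℤ) = k - 1 - j := by omega
  rw [e]
  congr 1
  apply Int.ModEq.symm
  refine (Int.modEq_iff_dvd).2 ⟨-(c + 1), ?_⟩
  subst hc
  ring
end

section
/- Let k be a positive integer and let i be any integer. Then, as an identity of complex numbers, [i] = (2k−1)/2 − Σ_{ζ^{2k}=1, ζ≠1} ζ^{i+1}/(ζ − 1), where the sum runs over all complex 2k-th roots of unity ζ different from 1, and ζ^{i+1} denotes the integer power of the nonzero complex number ζ. -/
open Polynomial in
theorem aux_sum_pow (n m : ℕ) (hm : 0 < m) (hmn : m < n) :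
    ∑ ζ ∈ nthRootsFinset n (1 : ℂ), ζ ^ m = 0 := by
  have hn : 0 < n := by omega
  have hω := Complex.isPrimitiveRoot_exp n hn.ne'
  set ω := Complex.exp (2 * Real.pi * Complex.I / n) with hωd
  have hω0 : ω ≠ 0 := Complex.exp_ne_zero _
  have hne : ω ^ m ≠ 1 := hω.pow_ne_one_of_pos_of_lt hm.ne' hmn
  have h : ∑ ζ ∈ nthRootsFinset n (1 : ℂ), (ω * ζ) ^ m
      = ∑ ζ ∈ nthRootsFinset n (1 : ℂ), ζ ^ m := by
    refine Finset.sum_nbij' (fun z => ω * z) (fun z => ω⁻¹ * z) ?_ ?_ ?_ ?_ ?_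
    · intro z hz
      rw [mem_nthRootsFinset hn] at hz ⊢
      rw [mul_pow, hz, hω.pow_eq_one, one_mul]
    · intro z hz
      rw [mem_nthRootsFinset hn] at hz ⊢
      rw [mul_pow, hz, inv_pow, hω.pow_eq_one, inv_one, one_mul]
    · intro z _
      field_simp
    · intro z _
      field_simp
    · intro z _
      rfl
  simp only [mul_pow, ← Finset.mul_sum] at h
  have h2 : (ω ^ m - 1) * ∑ ζ ∈ nthRootsFinset n (1 : ℂ), ζ ^ m = 0 := by
    rw [sub_mul, h, one_mul, sub_self]
  exact (mul_eq_zero.1 h2).resolve_left (sub_ne_zero.2 hne)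

open Polynomial in
theorem aux_base (n : ℕ) (hn : 0 < n) :
    ∑ ζ ∈ (nthRootsFinset n (1 : ℂ)).erase 1, ζ / (ζ - 1) = ((n : ℂ) - 1) / 2 := by
  have one_mem : (1 : ℂ) ∈ nthRootsFinset n (1 : ℂ) := by
    rw [mem_nthRootsFinset hn, one_pow]
  have hcard : (((nthRootsFinset n (1 : ℂ)).erase 1).card : ℂ) = (n : ℂ) - 1 := by
    rw [Finset.card_erase_of_mem one_mem,
      (Complex.isPrimitiveRoot_exp n hn.ne').card_nthRootsFinset, Nat.cast_sub hn, Nat.cast_one]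
  have hinv : ∀ z ∈ (nthRootsFinset n (1 : ℂ)).erase 1,
      z⁻¹ ∈ (nthRootsFinset n (1 : ℂ)).erase 1 := by
    intro z hz
    rw [Finset.mem_erase, mem_nthRootsFinset hn] at hz ⊢
    exact ⟨fun h => hz.1 (inv_eq_one.1 h), by rw [inv_pow, hz.2, inv_one]⟩
  have h : ∑ ζ ∈ (nthRootsFinset n (1 : ℂ)).erase 1, ζ⁻¹ / (ζ⁻¹ - 1)
      = ∑ ζ ∈ (nthRootsFinset n (1 : ℂ)).erase 1, ζ / (ζ - 1) :=
    Finset.sum_nbij' (fun z => z⁻¹) (fun z => z⁻¹) hinv hinv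
      (fun z _ => inv_inv z) (fun z _ => inv_inv z) (fun z _ => rfl)
  have h2 : ∑ ζ ∈ (nthRootsFinset n (1 : ℂ)).erase 1, (ζ⁻¹ / (ζ⁻¹ - 1) + ζ / (ζ - 1))
      = (n : ℂ) - 1 := by
    rw [← hcard, Finset.cast_card]
    refine Finset.sum_congr rfl fun z hz => ?_
    rw [Finset.mem_erase, mem_nthRootsFinset hn] at hz
    have hz0 : z ≠ 0 := by
      rintro rfl
      rw [zero_pow hn.ne'] at hz
      exact zero_ne_one hz.2
    have h1 : z - 1 ≠ 0 := sub_ne_zero.2 hz.1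
    have e : z⁻¹ - 1 = -(z - 1) / z := by field_simp; ring
    rw [e]
    field_simp
    ring
  rw [Finset.sum_add_distrib, h] at h2
  linear_combination h2 / 2

open Polynomial in
theorem aux_main (n : ℕ) (hn : 0 < n) (r : ℕ) (hr : r < n) :
    ∑ ζ ∈ (nthRootsFinset n (1 : ℂ)).erase 1, ζ ^ (r + 1) / (ζ - 1)
      = ((n : ℂ) - 1) / 2 - r := by
  induction r with
  | zero => simpa using aux_base n hn
  | succ r ih =>
    have one_mem : (1 : ℂ) ∈ nthRootsFinset n (1 : ℂ) := by
      rw [mem_nthRootsFinset hn, one_pow]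
    have h := aux_sum_pow n (r + 1) (by omega) hr
    rw [← Finset.add_sum_erase _ _ one_mem, one_pow] at h
    have h3 : ∑ ζ ∈ (nthRootsFinset n (1 : ℂ)).erase 1, ζ ^ (r + 1 + 1) / (ζ - 1)
        = ∑ ζ ∈ (nthRootsFinset n (1 : ℂ)).erase 1, ζ ^ (r + 1) / (ζ - 1)
        + ∑ ζ ∈ (nthRootsFinset n (1 : ℂ)).erase 1, ζ ^ (r + 1) := by
      rw [← Finset.sum_add_distrib]
      refine Finset.sum_congr rfl fun z hz => ?_
      have h1 : z - 1 ≠ 0 := sub_ne_zero.2 (Finset.ne_of_mem_erase hz)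
      field_simp
      ring
    rw [h3, ih (by omega)]
    push_cast
    linear_combination h

theorem residue_as_root_of_unity_sum (k : ℕ) (hk : 0 < k) (i : ℤ) :
    ((i % (2 * (k : ℤ)) : ℤ) : ℂ) =
      (2 * (k : ℂ) - 1) / 2 -
        ∑ᶠ ζ ∈ {ζ : ℂ | ζ ^ (2 * k) = 1 ∧ ζ ≠ 1}, ζ ^ (i + 1) / (ζ - 1) := by
  have hn : 0 < 2 * k := by omega
  have hset : {ζ : ℂ | ζ ^ (2 * k) = 1 ∧ ζ ≠ 1}
      = (((Polynomial.nthRootsFinset (2 * k) (1 : ℂ)).erase 1 : Finset ℂ) : Set ℂ) := by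
    ext z
    rw [Finset.mem_coe, Finset.mem_erase, Polynomial.mem_nthRootsFinset hn]
    exact and_comm
  rw [hset, finsum_mem_coe_finset]
  obtain ⟨r, hr⟩ := Int.eq_ofNat_of_zero_le (Int.emod_nonneg i (b := 2 * (k : ℤ)) (by omega))
  have hlt : r < 2 * k := by
    have := Int.emod_lt_of_pos i (b := 2 * (k : ℤ)) (by omega)
    omega
  have hi : i + 1 = ((2 * k : ℕ) : ℤ) * (i / (2 * (k : ℤ))) + ((r + 1 : ℕ) : ℤ) := by
    have := Int.mul_ediv_add_emod i (2 * (k : ℤ))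
    push_cast
    linarith
  have hsum : ∑ ζ ∈ (Polynomial.nthRootsFinset (2 * k) (1 : ℂ)).erase 1, ζ ^ (i + 1) / (ζ - 1)
      = ∑ ζ ∈ (Polynomial.nthRootsFinset (2 * k) (1 : ℂ)).erase 1, ζ ^ (r + 1) / (ζ - 1) := by
    refine Finset.sum_congr rfl fun z hz => ?_
    rw [Finset.mem_erase, Polynomial.mem_nthRootsFinset hn] at hz
    have hz0 : z ≠ 0 := by
      rintro rfl
      rw [zero_pow hn.ne'] at hz
      exact zero_ne_one hz.2
    rw [hi, zpow_add₀ hz0, zpow_mul, zpow_natCast, hz.2, one_zpow, one_mul, zpow_natCast]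
  rw [hsum, aux_main (2 * k) hn r hlt, hr]
  push_cast
  ring
end
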